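/- arXiv:2305.02566 — 2 statements merged into one kernel-verified Lean document; each statement's English description precedes it below -/
import Mathlib

section
/- Let h ∈ ℝ[x₁,…,x_m] be a degree-d polynomial hyperbolic with respect to e ∈ Γ₊₊, let v₁,…,vₙ ∈ Γ₊ satisfy Σ_{i=1}^n vᵢ = e and tr_h[vᵢ] ≤ ε₂ for all i, and let μ be a d_μ-homogeneous strongly Rayleigh probability distribution on subsets of [n] with generating polynomial g_μ such that the marginal probability Pr_{S∼μ}[i ∈ S] of each element i ∈ [n] is at most ε₁. Set ε = ε₁ + ε₂. Then the point (√(4ε + 2ε²), 0, …, 0) ∈ ℝ^{n+1} is above all roots of the polynomial ∏_{i=1}^n (1 − (1/2)∂²_{zᵢ}) [ h(xe + Σ_{i=1}^n zᵢvᵢ) · g_μ(x·𝟏 + z) ] ∈ ℝ[x, z₁,…,zₙ]. -/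
open MvPolynomial Finset
open scoped Classical

noncomputable section

/-- `h` is homogeneous of degree `d`, positive at `e`, and for every `x` the univariate
polynomial `t ↦ h (t • e - x)` factors with real roots `lam x 1 ≥ … ≥ lam x d`
(the hyperbolic eigenvalues of `x`). -/
def IsHyperbolic {m d : ℕ} (h : MvPolynomial (Fin m) ℝ) (e : Fin m → ℝ)
    (lam : (Fin m → ℝ) → Fin d → ℝ) : Prop :=
  h.IsHomogeneous d ∧ 0 < eval e h ∧ (∀ x, Antitone (lam x)) ∧
    ∀ x : Fin m → ℝ, ∀ t : ℝ,
      eval (t • e - x) h = eval e h * ∏ i, (t - lam x i)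

/-- hyperbolic trace: the sum of the hyperbolic eigenvalues. -/
def htrace {m d : ℕ} (lam : (Fin m → ℝ) → Fin d → ℝ) (x : Fin m → ℝ) : ℝ :=
  ∑ i, lam x i

/-- hyperbolic rank: the number of nonzero hyperbolic eigenvalues. -/
def hrank {m d : ℕ} (lam : (Fin m → ℝ) → Fin d → ℝ) (x : Fin m → ℝ) : ℕ :=
  Nat.card {i : Fin d // lam x i ≠ 0}

/-- hyperbolic norm: the largest absolute value of a hyperbolic eigenvalue. -/
def hnorm {m d : ℕ} (lam : (Fin m → ℝ) → Fin d → ℝ) (x : Fin m → ℝ) : ℝ :=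
  ⨆ i, |lam x i|

/-- closed hyperbolicity cone: all hyperbolic eigenvalues nonnegative. -/
def InCone {m d : ℕ} (lam : (Fin m → ℝ) → Fin d → ℝ) (x : Fin m → ℝ) : Prop :=
  ∀ i, 0 ≤ lam x i

/-- open hyperbolicity cone: all hyperbolic eigenvalues positive. -/
def InOpenCone {m d : ℕ} (lam : (Fin m → ℝ) → Fin d → ℝ) (x : Fin m → ℝ) : Prop :=
  ∀ i, 0 < lam x i

/-- A real polynomial is real stable if it has no zero with all coordinates in the
open upper half plane. -/
def RealStable {k : ℕ} (p : MvPolynomial (Fin k) ℝ) : Prop :=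
  ∀ z : Fin k → ℂ, (∀ i, 0 < (z i).im) → (aeval z p : ℂ) ≠ 0

/-- generating polynomial of a distribution on subsets of `[n]`. -/
def genPoly {n : ℕ} (μ : Finset (Fin n) → ℝ) : MvPolynomial (Fin n) ℝ :=
  ∑ S : Finset (Fin n), C (μ S) * ∏ i ∈ S, X i

/-- `μ` is a probability distribution on subsets of `[n]`. -/
def IsProbDist {n : ℕ} (μ : Finset (Fin n) → ℝ) : Prop :=
  (∀ S, 0 ≤ μ S) ∧ ∑ S : Finset (Fin n), μ S = 1

/-- the `(n+1)`-variate polynomial `h (x • e + ∑ i, z i • w i)` in variables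
`x = X 0` and `z i = X i.succ`. -/
def hPoly {m n : ℕ} (h : MvPolynomial (Fin m) ℝ) (e : Fin m → ℝ)
    (w : Fin n → Fin m → ℝ) : MvPolynomial (Fin (n + 1)) ℝ :=
  aeval (fun j : Fin m =>
    X (0 : Fin (n + 1)) * C (e j) + ∑ i : Fin n, X i.succ * C (w i j)) h

/-- apply the operator `∏ i (1 - (1/2) ∂²_{z i})` to a polynomial in variables
`x = X 0, z 1 = X 1, …, z n = X n`. -/
def opAll {n : ℕ} (P : MvPolynomial (Fin (n + 1)) ℝ) : MvPolynomial (Fin (n + 1)) ℝ :=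
  (List.finRange n).foldl
    (fun Q i => Q - C (1 / 2 : ℝ) * pderiv i.succ (pderiv i.succ Q)) P

/-- `y` is above all roots of `P`: `P` is positive on `y` plus the nonnegative orthant. -/
def AboveRoots {k : ℕ} (P : MvPolynomial (Fin k) ℝ) (y : Fin k → ℝ) : Prop :=
  ∀ t : Fin k → ℝ, (∀ i, 0 ≤ t i) → 0 < eval (y + t) P

namespace Polynomial

open scoped Polynomial

/-- If all roots of `Q` lie weakly below `x`, the logarithmic derivative of `Q` at `x` has
nonpositive imaginary part. -/
lemma im_logDeriv_nonpos (Q : ℂ[X]) (x : ℂ) (hx : Q.eval x ≠ 0)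
    (hr : ∀ r ∈ Q.roots, r.im ≤ x.im) :
    ((derivative Q).eval x / Q.eval x).im ≤ 0 := by
  rw [(IsAlgClosed.splits Q).eval_derivative_div_eval_of_ne_zero hx]
  have key : ∀ s : Multiset ℂ, (∀ r ∈ s, r.im ≤ x.im) →
      ((s.map fun z => 1 / (x - z)).sum).im ≤ 0 := by
    intro s
    induction s using Multiset.induction_on with
    | empty => simp
    | cons a s ih =>
      intro h
      have h1 := ih fun r hr => h r (Multiset.mem_cons_of_mem hr)
      have h2 : (1 / (x - a)).im ≤ 0 := by
        rw [one_div, Complex.inv_im]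
        apply div_nonpos_of_nonpos_of_nonneg _ (Complex.normSq_nonneg _)
        have := h a (Multiset.mem_cons_self a s)
        simp; linarith
      rw [Multiset.map_cons, Multiset.sum_cons, Complex.add_im]
      linarith
  exact key _ hr

/-- If all roots of `Q` lie weakly below and to the left of `x`, then `-(log Q)''` at `x` has
nonpositive imaginary part. -/
lemma im_neg_logDeriv_deriv_nonpos (Q : ℂ[X]) (x : ℂ) (hx : Q.eval x ≠ 0)
    (hr : ∀ r ∈ Q.roots, r.im ≤ x.im ∧ r.re ≤ x.re) :
    (((derivative Q).eval x ^ 2 - Q.eval x * (derivative (derivative Q)).eval x)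
      / Q.eval x ^ 2).im ≤ 0 := by
  have key : ∀ (c : ℂ) (s : Multiset ℂ), (∀ r ∈ s, r.im ≤ x.im ∧ r.re ≤ x.re) →
      ∀ R : ℂ[X], R = C c * (s.map fun a => X - C a).prod → R.eval x ≠ 0 →
      (((derivative R).eval x ^ 2 - R.eval x * (derivative (derivative R)).eval x)
        / R.eval x ^ 2).im ≤ 0 := by
    intro c s
    induction s using Multiset.induction_on with
    | empty => rintro - R rfl -; simp
    | cons a s ih =>
      rintro h R rfl hR
      have h1 := ih (fun r hr => h r (Multiset.mem_cons_of_mem hr)) _ rfl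
      obtain ⟨ha, hb⟩ := h a (Multiset.mem_cons_self a s)
      rw [Multiset.map_cons, Multiset.prod_cons, mul_left_comm] at hR ⊢
      generalize C c * (s.map fun a => X - C a).prod = T at *
      have hxa : x - a ≠ 0 := by intro h0; simp [h0] at hR
      have hT : T.eval x ≠ 0 := by intro h0; simp [h0] at hR
      have h2 : (((derivative ((X - C a) * T)).eval x ^ 2 - ((X - C a) * T).eval x *
          (derivative (derivative ((X - C a) * T))).eval x) / ((X - C a) * T).eval x ^ 2) =
          1 / (x - a) ^ 2 + ((derivative T).eval x ^ 2 -
            T.eval x * (derivative (derivative T)).eval x) / T.eval x ^ 2 := by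
        simp only [derivative_mul, derivative_sub, derivative_X, derivative_C, eval_add, eval_mul,
          eval_sub, eval_X, eval_C, derivative_add, sub_zero, one_mul]
        field_simp
        ring
      have h3 : (1 / (x - a) ^ 2).im ≤ 0 := by
        rw [one_div, Complex.inv_im]
        apply div_nonpos_of_nonpos_of_nonneg _ (Complex.normSq_nonneg _)
        have : ((x - a) ^ 2).im = 2 * ((x.re - a.re) * (x.im - a.im)) := by
          rw [sq, Complex.mul_im, Complex.sub_re, Complex.sub_im]; ring
        rw [this]
        nlinarith [mul_nonneg (sub_nonneg.2 hb) (sub_nonneg.2 ha)]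
      rw [h2, Complex.add_im]
      linarith [h1 hT]
  exact key Q.leadingCoeff Q.roots hr Q (IsAlgClosed.splits Q).eq_prod_roots hx

/-- The rational function `q / f` is nonnegative without poles on `[0, ∞)` and maps the upper
half plane to the closed lower half plane. -/
structure IsPickPair (f q : ℝ[X]) : Prop where
  pos : ∀ s : ℝ, 0 ≤ s → 0 < f.eval s
  nonneg : ∀ s : ℝ, 0 ≤ s → 0 ≤ q.eval s
  ne_zero : ∀ z : ℂ, 0 < z.im → aeval z f ≠ 0
  im_nonpos : ∀ z : ℂ, 0 < z.im → (aeval z q / aeval z f).im ≤ 0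

namespace IsPickPair

variable {f q : ℝ[X]}

/-- The Hermite-Biehler polynomial `f + i η q`. -/
noncomputable def hbPoly (f q : ℝ[X]) (η : ℝ) : ℂ[X] :=
  f.map Complex.ofRealHom + C (Complex.I * η) * q.map Complex.ofRealHom

lemma eval_map_ofReal (f : ℝ[X]) (z : ℂ) : (f.map Complex.ofRealHom).eval z = aeval z f := by
  rw [Polynomial.eval_map, Polynomial.aeval_def]; rfl

lemma aeval_ofReal' (f : ℝ[X]) (x : ℝ) : aeval (x : ℂ) f = ((f.eval x : ℝ) : ℂ) := by
  have := Polynomial.aeval_algebraMap_apply ℂ x f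
  simpa using this

lemma eval_hbPoly (η : ℝ) (z : ℂ) :
    (hbPoly f q η).eval z = aeval z f + Complex.I * η * aeval z q := by
  simp [hbPoly, eval_map_ofReal]

lemma derivative_hbPoly (η : ℝ) :
    derivative (hbPoly f q η) = hbPoly (derivative f) (derivative q) η := by
  simp [hbPoly, derivative_map]

lemma hbPoly_ne_zero (h : IsPickPair f q) {η : ℝ} (hη : 0 ≤ η) {z : ℂ} (hz : 0 < z.im) :
    (hbPoly f q η).eval z ≠ 0 := by
  have h1 := h.ne_zero z hz
  have h2 := h.im_nonpos z hz
  intro h0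
  rw [eval_hbPoly] at h0
  have h3 : 1 + Complex.I * η * (aeval z q / aeval z f) = 0 := by
    field_simp
    simpa using h0
  have h4 := congrArg Complex.re h3
  simp at h4
  nlinarith

lemma hbPoly_ofReal_ne_zero (h : IsPickPair f q) (η : ℝ) {x : ℝ} (hx : 0 ≤ x) :
    (hbPoly f q η).eval (x : ℂ) ≠ 0 := by
  intro h0
  rw [eval_hbPoly, aeval_ofReal', aeval_ofReal'] at h0
  have h4 := congrArg Complex.re h0
  simp at h4
  linarith [h.pos x hx]

lemma im_root_nonpos (h : IsPickPair f q) {η : ℝ} (hη : 0 ≤ η) {r : ℂ}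
    (hr : r ∈ (hbPoly f q η).roots) : r.im ≤ 0 := by
  by_contra! hc
  exact h.hbPoly_ne_zero hη hc (isRoot_of_mem_roots hr)

/-- `q / f` is nonincreasing on `[0, ∞)`, in derivative form. -/
lemma wronskian_nonpos (h : IsPickPair f q) {x : ℝ} (hx : 0 ≤ x) :
    (derivative q).eval x * f.eval x - q.eval x * (derivative f).eval x ≤ 0 := by
  have h1 := im_logDeriv_nonpos (hbPoly f q 1) x (h.hbPoly_ofReal_ne_zero 1 hx)
    fun r hr => by simpa using h.im_root_nonpos zero_le_one hr
  rw [derivative_hbPoly, eval_hbPoly, eval_hbPoly, Complex.div_im] at h1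
  simp only [aeval_ofReal'] at h1
  have h2 : 0 < Complex.normSq ((f.eval x : ℝ) + Complex.I * (1 : ℝ) * (q.eval x : ℝ)) := by
    rw [Complex.normSq_pos]
    have := h.hbPoly_ofReal_ne_zero 1 hx
    rwa [eval_hbPoly, aeval_ofReal', aeval_ofReal'] at this
  rw [← sub_div, div_nonpos_iff] at h1
  rcases h1 with h1 | h1
  · linarith [h1.2]
  · have := h1.1
    simp at this
    linarith

lemma hasDerivAt_div (h : IsPickPair f q) {x : ℝ} (hx : 0 ≤ x) :
    HasDerivAt (fun s => q.eval s / f.eval s)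
      (((derivative q).eval x * f.eval x - q.eval x * (derivative f).eval x) / f.eval x ^ 2) x :=
  (q.hasDerivAt x).div (f.hasDerivAt x) (h.pos x hx).ne'

lemma antitoneOn_div (h : IsPickPair f q) :
    AntitoneOn (fun s => q.eval s / f.eval s) (Set.Ici 0) := by
  apply antitoneOn_of_deriv_nonpos (convex_Ici 0)
  · exact fun x hx => (h.hasDerivAt_div hx).continuousAt.continuousWithinAt
  · intro x hx
    rw [interior_Ici] at hx
    exact (h.hasDerivAt_div (le_of_lt hx)).differentiableAt.differentiableWithinAt
  · intro x hx
    rw [interior_Ici] at hx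
    rw [(h.hasDerivAt_div (le_of_lt hx)).deriv]
    exact div_nonpos_of_nonpos_of_nonneg (h.wronskian_nonpos (le_of_lt hx)) (sq_nonneg _)

lemma degree_le (h : IsPickPair f q) : q.degree ≤ f.degree := by
  by_contra! hc
  have h0 : f ≠ 0 := by rintro rfl; simpa using h.pos 0 le_rfl
  have h1 := Polynomial.abs_div_tendsto_atTop_atTop_of_degree_gt q f hc h0
  have h2 := (h1.eventually_gt_atTop (q.eval 0 / f.eval 0)).and (Filter.eventually_ge_atTop 0)
  obtain ⟨x, hx1, hx2⟩ := h2.exists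
  have h3 := h.antitoneOn_div Set.self_mem_Ici hx2 hx2
  rw [abs_of_nonneg (div_nonneg (h.nonneg x hx2) (h.pos x hx2).le)] at hx1
  simp only at h3
  linarith

lemma aeval_ne_zero (h : IsPickPair f q) {z : ℂ} (hz : 0 ≤ z.re) : aeval z f ≠ 0 := by
  rcases lt_trichotomy z.im 0 with h1 | h1 | h1
  · intro h0
    refine h.ne_zero (starRingEnd ℂ z) (by simpa using h1) ?_
    rw [Polynomial.aeval_conj, h0, map_zero]
  · have : z = (z.re : ℂ) := Complex.ext (by simp) (by simp [h1])
    rw [this, aeval_ofReal']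
    exact_mod_cast (h.pos _ hz).ne'
  · exact h.ne_zero z h1

lemma exists_norm_div_le (h : IsPickPair f q) :
    ∃ M : ℝ, 0 < M ∧ ∀ z : ℂ, 0 ≤ z.re → ‖aeval z q / aeval z f‖ ≤ M := by
  have hd : (q.map Complex.ofRealHom).degree ≤ (f.map Complex.ofRealHom).degree := by
    simpa [degree_map] using h.degree_le
  have h1 := isBigO_cobounded_of_degree_le hd
  obtain ⟨M₁, h2⟩ := h1.bound
  have h3 : ∀ᶠ z : ℂ in Bornology.cobounded ℂ, 0 ≤ z.re →
      ‖aeval z q / aeval z f‖ ≤ M₁ := by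
    filter_upwards [h2] with z hz hre
    rw [eval_map_ofReal, eval_map_ofReal] at hz
    rwa [norm_div, div_le_iff₀ (norm_pos_iff.2 (h.aeval_ne_zero hre))]
  rw [Filter.HasBasis.eventually_iff
    (Metric.hasBasis_cobounded_compl_closedBall (0 : ℂ))] at h3
  obtain ⟨R, -, h3⟩ := h3
  have hK : IsCompact (Metric.closedBall (0 : ℂ) R ∩ {z | 0 ≤ z.re}) :=
    (isCompact_closedBall _ _).inter_right (isClosed_le continuous_const Complex.continuous_re)
  obtain ⟨M₂, h4⟩ := hK.exists_bound_of_continuousOn (f := fun z => aeval z q / aeval z f)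
    (ContinuousOn.div (Polynomial.continuous_aeval q).continuousOn
      (Polynomial.continuous_aeval f).continuousOn fun z hz => h.aeval_ne_zero hz.2)
  refine ⟨max 1 (max M₁ M₂), lt_of_lt_of_le one_pos (le_max_left _ _), fun z hz => ?_⟩
  by_cases hzR : z ∈ Metric.closedBall (0 : ℂ) R
  · exact (h4 z ⟨hzR, hz⟩).trans ((le_max_right _ _).trans (le_max_right _ _))
  · exact (h3 hzR hz).trans ((le_max_left _ _).trans (le_max_right _ _))

/-- `q / f` is convex on `[0, ∞)`, in derivative form. -/
lemma second_deriv_nonneg (h : IsPickPair f q) {x : ℝ} (hx : 0 ≤ x) :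
    0 ≤ (derivative (derivative q)).eval x * f.eval x ^ 2
      - q.eval x * f.eval x * (derivative (derivative f)).eval x
      - 2 * f.eval x * (derivative f).eval x * (derivative q).eval x
      + 2 * q.eval x * (derivative f).eval x ^ 2 := by
  obtain ⟨M, hM, hb⟩ := h.exists_norm_div_le
  have key : ∀ η : ℝ, 0 < η → η * M < 1 →
      (((derivative (hbPoly f q η)).eval (x : ℂ) ^ 2 - (hbPoly f q η).eval (x : ℂ) *
        (derivative (derivative (hbPoly f q η))).eval (x : ℂ))
        / (hbPoly f q η).eval (x : ℂ) ^ 2).im ≤ 0 := by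
    intro η hη hηM
    refine im_neg_logDeriv_deriv_nonpos _ _ (h.hbPoly_ofReal_ne_zero η hx) fun r hr => ?_
    refine ⟨by simpa using h.im_root_nonpos hη.le hr, ?_⟩
    rw [Complex.ofReal_re]
    by_contra! hc
    have hre : 0 ≤ r.re := by linarith
    have hf := h.aeval_ne_zero hre
    have h0 : (hbPoly f q η).eval r = 0 := isRoot_of_mem_roots hr
    rw [eval_hbPoly] at h0
    have h1 : Complex.I * η * (aeval r q / aeval r f) = -1 := by
      field_simp
      linear_combination h0
    have h2 := congrArg norm h1
    rw [norm_mul, norm_mul, Complex.norm_I, Complex.norm_real, Real.norm_of_nonneg hη.le,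
      norm_neg, norm_one, one_mul] at h2
    nlinarith [hb r hre]
  simp only [derivative_hbPoly, eval_hbPoly, aeval_ofReal'] at key
  have hf := h.pos x hx
  set a := f.eval x
  set b := q.eval x
  set a' := (derivative f).eval x
  set b' := (derivative q).eval x
  set a'' := (derivative (derivative f)).eval x
  set b'' := (derivative (derivative q)).eval x
  by_contra! hneg
  set A := a * (b'' * a ^ 2 - b * a * a'' - 2 * a * a' * b' + 2 * b * a' ^ 2) with hA
  have hA0 : A < 0 := mul_neg_of_pos_of_neg hf hneg
  set B := -2 * a * b * (b * b'' - b' ^ 2) - b ^ 2 * (2 * a' * b' - a * b'' - b * a'') with hB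
  have key2 : ∀ η : ℝ, 0 < η → η * M < 1 → -A + η ^ 2 * B ≤ 0 := by
    intro η hη hηM
    have h1 := key η hη hηM
    rw [Complex.div_im, ← sub_div, div_nonpos_iff] at h1
    have h2 : 0 < Complex.normSq (((a : ℂ) + Complex.I * η * b) ^ 2) := by
      rw [Complex.normSq_pos]
      intro h0
      have := congrArg Complex.re (pow_eq_zero_iff (two_ne_zero) |>.1 h0)
      simp at this
      exact hf.ne' this
    rcases h1 with h1 | h1
    · linarith [h1.2]
    · have h3 := h1.1
      simp [sq] at h3
      have h4 : η * (-A + η ^ 2 * B) ≤ 0 := by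
        rw [hA, hB]
        linarith
      exact nonpos_of_mul_nonpos_right h4 hη
  have lim : Filter.Tendsto (fun η : ℝ => -A + η ^ 2 * B) (nhdsWithin 0 (Set.Ioi 0))
      (nhds (-A)) := by
    have : Continuous fun η : ℝ => -A + η ^ 2 * B := by fun_prop
    have h1 := this.tendsto 0
    simp only [ne_eq, OfNat.ofNat_ne_zero, not_false_eq_true, zero_pow, zero_mul, add_zero] at h1
    exact h1.mono_left nhdsWithin_le_nhds
  have : -A ≤ 0 := by
    refine le_of_tendsto lim ?_
    have h1 : ∀ᶠ η : ℝ in nhdsWithin 0 (Set.Ioi 0), η < 1 / M :=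
      nhdsWithin_le_nhds (eventually_lt_nhds (by positivity))
    filter_upwards [h1, self_mem_nhdsWithin] with η h2 h3
    exact key2 η h3 (by rwa [lt_div_iff₀ hM] at h2)
  linarith

/-- The convexity inequality for `q / f` between `0` and `δ`. -/
lemma tangent_le (h : IsPickPair f q) {δ : ℝ} (hδ : 0 < δ) :
    q.eval δ / f.eval δ - δ * (((derivative q).eval δ * f.eval δ
      - q.eval δ * (derivative f).eval δ) / f.eval δ ^ 2) ≤ q.eval 0 / f.eval 0 := by
  set G : ℝ → ℝ := fun s =>
    ((derivative q).eval s * f.eval s - q.eval s * (derivative f).eval s) / f.eval s ^ 2 with hG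
  have hder : ∀ x : ℝ, 0 ≤ x → HasDerivAt G
      ((((derivative (derivative q)).eval x * f.eval x + (derivative q).eval x *
        (derivative f).eval x - ((derivative q).eval x * (derivative f).eval x +
        q.eval x * (derivative (derivative f)).eval x)) * f.eval x ^ 2 -
        ((derivative q).eval x * f.eval x - q.eval x * (derivative f).eval x) *
        (2 * f.eval x * (derivative f).eval x)) / (f.eval x ^ 2) ^ 2) x := by
    intro x hx
    have h1 := ((derivative q).hasDerivAt x).mul (f.hasDerivAt x)
    have h2 := (q.hasDerivAt x).mul ((derivative f).hasDerivAt x)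
    have h3 := (f.hasDerivAt x).pow 2
    have h4 := (h1.sub h2).div h3 (pow_ne_zero 2 (h.pos x hx).ne')
    convert! h4 using 1
    simp
  have hmono : MonotoneOn G (Set.Ici 0) := by
    apply monotoneOn_of_deriv_nonneg (convex_Ici 0)
    · exact fun x hx => (hder x hx).continuousAt.continuousWithinAt
    · intro x hx
      rw [interior_Ici] at hx
      exact (hder x (le_of_lt hx)).differentiableAt.differentiableWithinAt
    · intro x hx
      rw [interior_Ici] at hx
      have hx' : 0 ≤ x := le_of_lt hx
      rw [(hder x hx').deriv]
      apply div_nonneg _ (by positivity)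
      have := mul_nonneg (h.pos x hx').le (h.second_deriv_nonneg hx')
      linarith
  obtain ⟨c, hc, hc2⟩ := exists_hasDerivAt_eq_slope (fun s => q.eval s / f.eval s) G hδ
    (fun x hx => (h.hasDerivAt_div hx.1).continuousAt.continuousWithinAt)
    (fun x hx => h.hasDerivAt_div hx.1.le)
  have h1 := hmono (Set.mem_Ici.2 hc.1.le) (Set.mem_Ici.2 hδ.le) hc.2.le
  rw [hc2, sub_zero, div_le_iff₀ hδ] at h1
  linarith

end IsPickPair

end Polynomial

namespace Polynomial

open scoped Polynomial

/-- If all roots of `Q` lie strictly below `x`, then the logarithmic derivative of `Q` at `x` is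
zero or lies in the open lower half plane. -/
lemma im_logDeriv_neg_or (Q : ℂ[X]) (x : ℂ) (hx : Q.eval x ≠ 0)
    (hr : ∀ r ∈ Q.roots, r.im < x.im) :
    ((derivative Q).eval x / Q.eval x).im < 0 ∨ (derivative Q).eval x / Q.eval x = 0 := by
  rcases eq_or_ne Q.roots 0 with h0 | h0
  · right
    rw [(IsAlgClosed.splits Q).eval_derivative_div_eval_of_ne_zero hx, h0]
    simp
  · left
    rw [(IsAlgClosed.splits Q).eval_derivative_div_eval_of_ne_zero hx]
    have key : ∀ s : Multiset ℂ, (∀ r ∈ s, r.im < x.im) →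
        s ≠ 0 → ((s.map fun z => 1 / (x - z)).sum).im < 0 := by
      intro s
      induction s using Multiset.induction_on with
      | empty => simp
      | cons a s ih =>
        intro h _
        have ha := h a (Multiset.mem_cons_self a s)
        have h2 : (1 / (x - a)).im < 0 := by
          rw [one_div, Complex.inv_im]
          apply div_neg_of_neg_of_pos
          · simpa using ha
          · rw [Complex.normSq_pos, sub_ne_zero]
            rintro rfl
            exact lt_irrefl _ ha
        rw [Multiset.map_cons, Multiset.sum_cons, Complex.add_im]
        rcases eq_or_ne s 0 with hs | hs
        · subst hs; simpa using h2
        · linarith [ih (fun r hr => h r (Multiset.mem_cons_of_mem hr)) hs]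
    exact key _ hr h0

/-- If all roots of `Q` lie weakly to the left of `x`, the logarithmic derivative of `Q` at `x` has
nonnegative real part. -/
lemma re_logDeriv_nonneg (Q : ℂ[X]) (x : ℂ) (hx : Q.eval x ≠ 0)
    (hr : ∀ r ∈ Q.roots, r.re ≤ x.re) :
    0 ≤ ((derivative Q).eval x / Q.eval x).re := by
  rw [(IsAlgClosed.splits Q).eval_derivative_div_eval_of_ne_zero hx]
  have key : ∀ s : Multiset ℂ, (∀ r ∈ s, r.re ≤ x.re) →
      0 ≤ ((s.map fun z => 1 / (x - z)).sum).re := by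
    intro s
    induction s using Multiset.induction_on with
    | empty => simp
    | cons a s ih =>
      intro h
      have h1 := ih fun r hr => h r (Multiset.mem_cons_of_mem hr)
      have h2 : 0 ≤ (1 / (x - a)).re := by
        rw [one_div, Complex.inv_re]
        apply div_nonneg _ (Complex.normSq_nonneg _)
        simpa using h a (Multiset.mem_cons_self a s)
      rw [Multiset.map_cons, Multiset.sum_cons, Complex.add_re]
      linarith
  exact key _ hr

/-- A quantitative lower bound for a polynomial without roots in the open upper half plane. -/
lemma norm_eval_ge (Q : ℂ[X]) {D : ℕ} (hD : Q.natDegree ≤ D)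
    (hr : ∀ r ∈ Q.roots, r.im ≤ 0) {s : ℂ} (hs : 0 < s.im) :
    (s.im / (‖s‖ + s.im)) ^ D * ‖Q.eval 0‖ ≤ ‖Q.eval s‖ := by
  set c := s.im / (‖s‖ + s.im) with hc
  have hpos : 0 < ‖s‖ + s.im := by positivity
  have hc0 : 0 ≤ c := by positivity
  have hc1 : c ≤ 1 := by
    rw [hc, div_le_one hpos]
    linarith [norm_nonneg s]
  have key : ∀ m : Multiset ℂ, (∀ r ∈ m, r.im ≤ 0) →
      c ^ m.card * ‖(m.map fun a => 0 - a).prod‖ ≤ ‖(m.map fun a => s - a).prod‖ := by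
    intro m
    induction m using Multiset.induction_on with
    | empty => simp
    | cons a m ih =>
      intro h
      have h1 := ih fun r hr => h r (Multiset.mem_cons_of_mem hr)
      have ha := h a (Multiset.mem_cons_self a m)
      have h2 : s.im ≤ ‖s - a‖ := by
        have := Complex.im_le_norm (s - a)
        rw [Complex.sub_im] at this
        linarith
      have h3 : c * ‖0 - a‖ ≤ ‖s - a‖ := by
        have h4 : ‖a‖ ≤ ‖s‖ + ‖s - a‖ := by
          have := norm_sub_le s (s - a)
          simpa using this
        rw [zero_sub, norm_neg, hc, div_mul_eq_mul_div, div_le_iff₀ hpos]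
        nlinarith [norm_nonneg s]
      simp only [Multiset.map_cons, Multiset.prod_cons, norm_mul, Multiset.card_cons, pow_succ]
      calc c ^ m.card * c * (‖0 - a‖ * ‖(m.map fun a => 0 - a).prod‖)
          = (c * ‖0 - a‖) * (c ^ m.card * ‖(m.map fun a => 0 - a).prod‖) := by ring
        _ ≤ _ := mul_le_mul h3 h1 (by positivity) (norm_nonneg _)
  have hsp := IsAlgClosed.splits Q
  calc c ^ D * ‖Q.eval 0‖ ≤ c ^ Q.roots.card * ‖Q.eval 0‖ := by
        gcongr ?_ * _
        exact pow_le_pow_of_le_one hc0 hc1 ((card_roots' Q).trans hD)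
    _ = ‖Q.leadingCoeff‖ * (c ^ Q.roots.card * ‖(Q.roots.map fun a => 0 - a).prod‖) := by
        rw [hsp.eval_eq_prod_roots, norm_mul]; ring
    _ ≤ ‖Q.leadingCoeff‖ * ‖(Q.roots.map fun a => s - a).prod‖ := by
        gcongr
        exact key _ hr
    _ = ‖Q.eval s‖ := by rw [hsp.eval_eq_prod_roots s, norm_mul]

end Polynomial

section Slices

variable {n : ℕ} {K : Type*} [CommRing K] [Algebra ℝ K]

/-- The restriction of `p` to the line `s ↦ w + s u`. -/
noncomputable def lineSlice (p : MvPolynomial (Fin n) ℝ) (w u : Fin n → K) : Polynomial K :=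
  aeval (fun k => Polynomial.C (w k) + Polynomial.C (u k) * Polynomial.X) p

lemma eval_lineSlice (p : MvPolynomial (Fin n) ℝ) (w u : Fin n → K) (s : K) :
    (lineSlice p w u).eval s = aeval (fun k => w k + s * u k) p := by
  induction p using MvPolynomial.induction_on with
  | C a => simp [lineSlice, Polynomial.algebraMap_apply]
  | add p q hp hq =>
    simp only [lineSlice, map_add, Polynomial.eval_add] at *
    rw [hp, hq]
  | mul_X p i hp =>
    simp only [lineSlice, map_mul, Polynomial.eval_mul, aeval_X] at *
    rw [hp, Polynomial.eval_add, Polynomial.eval_mul, Polynomial.eval_C, Polynomial.eval_C,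
      Polynomial.eval_X, mul_comm s]

lemma eval_lineSlice_real (p : MvPolynomial (Fin n) ℝ) (w u : Fin n → ℝ) (s : ℝ) :
    (lineSlice p w u).eval s = eval (w + s • u) p := by
  rw [eval_lineSlice, MvPolynomial.aeval_eq_eval]
  rfl

lemma aeval_lineSlice (p : MvPolynomial (Fin n) ℝ) (w u : Fin n → ℝ) (z : ℂ) :
    Polynomial.aeval z (lineSlice p w u) = aeval (fun k => (w k : ℂ) + z * u k) p := by
  induction p using MvPolynomial.induction_on with
  | C a => simp [lineSlice]
  | add p q hp hq =>
    simp only [lineSlice, map_add] at *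
    rw [hp, hq]
  | mul_X p i hp =>
    simp only [lineSlice, map_mul, aeval_X] at *
    rw [hp, map_add, map_mul, Polynomial.aeval_C, Polynomial.aeval_C, Polynomial.aeval_X,
      mul_comm z]
    rfl

lemma derivative_lineSlice (p : MvPolynomial (Fin n) ℝ) (w : Fin n → K) (i : Fin n) :
    Polynomial.derivative (lineSlice p w (Pi.single i 1)) =
      lineSlice (pderiv i p) w (Pi.single i 1) := by
  induction p using MvPolynomial.induction_on with
  | C a => simp [lineSlice, Polynomial.algebraMap_apply]
  | add p q hp hq =>
    simp only [lineSlice, map_add] at *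
    rw [hp, hq]
  | mul_X p k hp =>
    simp only [lineSlice, map_mul, aeval_X, Polynomial.derivative_mul, Derivation.leibniz,
      map_add, smul_eq_mul] at *
    rw [hp]
    rcases eq_or_ne k i with rfl | hk
    · simp
      ring
    · simp [Pi.single_eq_of_ne hk, pderiv_X_of_ne hk]
      ring

lemma natDegree_lineSlice_le (p : MvPolynomial (Fin n) ℝ) (w u : Fin n → ℂ) :
    (lineSlice p w u).natDegree ≤ p.totalDegree := by
  let q := MvPolynomial.map (algebraMap ℝ ℂ) p
  have h1 : lineSlice p w u =
      aeval (fun k => Polynomial.C (w k) + Polynomial.C (u k) * Polynomial.X) q := by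
    simp only [lineSlice, q, aeval_map_algebraMap]
  rw [h1]
  have h2 := MvPolynomial.aeval_natDegree_le (m := p.totalDegree) (n := 1) q
    (Finset.sup_mono (support_map_subset _ _))
    (fun k => Polynomial.C (w k) + Polynomial.C (u k) * Polynomial.X) fun i => by
      rw [add_comm]; exact Polynomial.natDegree_linear_le
  simpa using h2

lemma aeval_ofReal_eq (p : MvPolynomial (Fin n) ℝ) (w : Fin n → ℝ) :
    aeval (fun k => (w k : ℂ)) p = ((eval w p : ℝ) : ℂ) := by
  simpa [Function.comp_def] using MvPolynomial.aeval_algebraMap_apply ℂ w p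

end Slices

section Stability

variable {n : ℕ} {p : MvPolynomial (Fin n) ℝ}

lemma continuous_aeval_complex (p : MvPolynomial (Fin n) ℝ) :
    Continuous fun z : Fin n → ℂ => (aeval z p : ℂ) := by
  have h1 : (fun z : Fin n → ℂ => (aeval z p : ℂ)) =
      fun z => eval z (MvPolynomial.map (algebraMap ℝ ℂ) p) := by
    ext z
    rw [eval_map, aeval_def]
  rw [h1]
  exact MvPolynomial.continuous_eval _

/-- Moving into the upper half plane along a nonnegative direction from a nonzero of a stable
polynomial cannot produce a zero. -/
lemma RealStable.aeval_add_ne_zero (hp : RealStable p) {w : Fin n → ℂ} (hw : ∀ k, 0 ≤ (w k).im)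
    (hpw : (aeval w p : ℂ) ≠ 0) {u : Fin n → ℝ} (hu : ∀ k, 0 ≤ u k) {s : ℂ} (hs : 0 < s.im) :
    (aeval (fun k => w k + s * u k) p : ℂ) ≠ 0 := by
  have key : ∀ η : ℝ, 0 < η → (s.im / (‖s‖ + s.im)) ^ p.totalDegree *
      ‖(aeval (fun k => w k + η * Complex.I) p : ℂ)‖ ≤
        ‖(aeval (fun k => w k + η * Complex.I + s * u k) p : ℂ)‖ := by
    intro η hη
    have h1 := Polynomial.norm_eval_ge
      (lineSlice p (fun k => w k + η * Complex.I) fun k => (u k : ℂ)) (natDegree_lineSlice_le _ _ _)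
      (fun r hr => ?_) hs
    · simpa [eval_lineSlice] using h1
    · by_contra! hc
      have h2 := Polynomial.isRoot_of_mem_roots hr
      rw [Polynomial.IsRoot, eval_lineSlice] at h2
      refine hp _ (fun k => ?_) h2
      have := mul_nonneg hc.le (hu k)
      simp
      linarith [hw k]
  have lim1 : Filter.Tendsto (fun η : ℝ => (s.im / (‖s‖ + s.im)) ^ p.totalDegree *
      ‖(aeval (fun k => w k + η * Complex.I) p : ℂ)‖) (nhdsWithin 0 (Set.Ioi 0))
      (nhds ((s.im / (‖s‖ + s.im)) ^ p.totalDegree * ‖(aeval w p : ℂ)‖)) := by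
    have h1 : Continuous fun η : ℝ => (s.im / (‖s‖ + s.im)) ^ p.totalDegree *
        ‖(aeval (fun k => w k + η * Complex.I) p : ℂ)‖ :=
      continuous_const.mul ((continuous_aeval_complex p).comp (by fun_prop)).norm
    have h2 := h1.tendsto 0
    simp only [Complex.ofReal_zero, zero_mul, add_zero] at h2
    exact h2.mono_left nhdsWithin_le_nhds
  have lim2 : Filter.Tendsto (fun η : ℝ =>
      ‖(aeval (fun k => w k + η * Complex.I + s * u k) p : ℂ)‖) (nhdsWithin 0 (Set.Ioi 0))
      (nhds ‖(aeval (fun k => w k + s * u k) p : ℂ)‖) := by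
    have h1 : Continuous fun η : ℝ =>
        ‖(aeval (fun k => w k + η * Complex.I + s * u k) p : ℂ)‖ :=
      ((continuous_aeval_complex p).comp (by fun_prop)).norm
    have h2 := h1.tendsto 0
    simp only [Complex.ofReal_zero, zero_mul, add_zero] at h2
    exact h2.mono_left nhdsWithin_le_nhds
  have h1 := le_of_tendsto_of_tendsto lim1 lim2
    (by filter_upwards [self_mem_nhdsWithin] with η hη using key η hη)
  have h2 : 0 < (s.im / (‖s‖ + s.im)) ^ p.totalDegree * ‖(aeval w p : ℂ)‖ := by
    have := norm_pos_iff.2 hpw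
    positivity
  exact norm_pos_iff.1 (h2.trans_le h1)

lemma RealStable.add_pderiv (hp : RealStable p) (c : ℝ) (i : Fin n) :
    RealStable (p + C c * pderiv i p) := by
  intro z hz h0
  have h1 : (lineSlice p z (Pi.single i 1)).eval 0 ≠ 0 := by
    rw [eval_lineSlice]
    simpa using hp z hz
  have h2 := Polynomial.im_logDeriv_neg_or _ 0 h1 (fun r hr => ?_)
  · rw [derivative_lineSlice, eval_lineSlice, eval_lineSlice] at h2
    simp only [zero_mul, add_zero] at h2
    have hpz := hp z hz
    have h3 : 1 + c * ((aeval z (pderiv i p) : ℂ) / aeval z p) = 0 := by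
      field_simp
      simpa using h0
    rcases h2 with h2 | h2
    · have h4 := congrArg Complex.im h3
      have h5 := congrArg Complex.re h3
      simp only [Complex.add_im, Complex.add_re, Complex.re_ofReal_mul, Complex.im_ofReal_mul,
        Complex.one_re, Complex.one_im, Complex.zero_re, Complex.zero_im, zero_add] at h4 h5
      rcases mul_eq_zero.1 h4 with h6 | h6
      · simp [h6] at h5
      · exact h2.ne h6
    · rw [h2] at h3
      simp at h3
  · by_contra! hc
    have h2 := Polynomial.isRoot_of_mem_roots hr
    rw [Polynomial.IsRoot, eval_lineSlice] at h2
    refine hp _ (fun k => ?_) h2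
    rcases eq_or_ne k i with rfl | hk
    · simp at hc ⊢
      linarith [hz k]
    · simpa [Pi.single_eq_of_ne hk] using hz k

/-- The operator `1 - (1/2) ∂²` in the `i`-th variable. -/
noncomputable def halfOp (i : Fin n) (p : MvPolynomial (Fin n) ℝ) : MvPolynomial (Fin n) ℝ :=
  p - C (1 / 2 : ℝ) * pderiv i (pderiv i p)

lemma RealStable.halfOp (hp : RealStable p) (i : Fin n) : RealStable (halfOp i p) := by
  have h1 := (hp.add_pderiv (-√(1 / 2)) i).add_pderiv (√(1 / 2)) i
  convert! h1 using 1
  have h2 : (C (1 / 2 : ℝ) : MvPolynomial (Fin n) ℝ) = C (√(1 / 2)) * C (√(1 / 2)) := by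
    rw [← C_mul, Real.mul_self_sqrt (by norm_num)]
  rw [_root_.halfOp, h2]
  simp only [map_add, Derivation.leibniz, smul_eq_mul, pderiv_C, mul_zero, add_zero]
  rw [C_neg]
  ring

/-- Along a nonnegative direction, a partial derivative of a stable polynomial and the polynomial
itself form a Pick pair on a ray starting above all roots. -/
lemma RealStable.isPickPair (hp : RealStable p) {y : Fin n → ℝ} (hy : AboveRoots p y)
    {u : Fin n → ℝ} (hu : ∀ k, 0 ≤ u k) (j : Fin n) :
    Polynomial.IsPickPair (lineSlice p y u) (lineSlice (pderiv j p) y u) := by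
  have hpos : ∀ (w u : Fin n → ℝ), AboveRoots p w → (∀ k, 0 ≤ u k) → ∀ s : ℝ, 0 ≤ s →
      0 < (lineSlice p w u).eval s := by
    intro w u hw hu s hs
    rw [eval_lineSlice_real]
    exact hw _ fun k => mul_nonneg hs (hu k)
  have hne : ∀ (w u : Fin n → ℝ), AboveRoots p w → (∀ k, 0 ≤ u k) → ∀ z : ℂ, 0 < z.im →
      Polynomial.aeval z (lineSlice p w u) ≠ 0 := by
    intro w u hw hu z hz
    rw [aeval_lineSlice]
    refine hp.aeval_add_ne_zero (by simp) ?_ hu hz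
    rw [aeval_ofReal_eq]
    have := hw 0 (fun _ => le_rfl)
    rw [add_zero] at this
    exact_mod_cast this.ne'
  have hsingle : ∀ k, 0 ≤ (Pi.single j 1 : Fin n → ℝ) k := by
    intro k
    by_cases h : k = j
    · subst h; simp
    · simp [Pi.single_eq_of_ne h]
  refine ⟨hpos y u hy hu, fun s hs => ?_, hne y u hy hu, fun z hz => ?_⟩
  · set w : Fin n → ℝ := y + s • u with hw
    have hwa : AboveRoots p w := by
      intro t ht
      rw [hw, add_assoc]
      exact hy _ fun k => add_nonneg (mul_nonneg hs (hu k)) (ht k)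
    have h0 : Polynomial.IsPickPair (lineSlice p w (Pi.single j 1)) 0 :=
      ⟨hpos w _ hwa hsingle, by simp, hne w _ hwa hsingle, by simp⟩
    have hc := h0.hbPoly_ofReal_ne_zero 0 le_rfl
    have h1 := Polynomial.re_logDeriv_nonneg _ _ hc (fun r hr => ?_)
    · rw [Polynomial.IsPickPair.derivative_hbPoly, Polynomial.IsPickPair.eval_hbPoly,
        Polynomial.IsPickPair.eval_hbPoly, derivative_lineSlice] at h1
      simp only [Polynomial.IsPickPair.aeval_ofReal'] at h1
      simp only [Complex.ofReal_zero, mul_zero, zero_mul, add_zero] at h1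
      rw [← Complex.ofReal_div, Complex.ofReal_re] at h1
      have h2 := hpos w _ hwa hsingle 0 le_rfl
      have h3 : 0 ≤ (lineSlice (pderiv j p) w (Pi.single j 1)).eval 0 := by
        by_contra! hcon
        exact absurd (div_neg_of_neg_of_pos hcon h2) (not_lt.2 h1)
      rw [eval_lineSlice_real]
      rw [eval_lineSlice_real] at h3
      simpa using h3
    · by_contra! hre
      have h2 := Polynomial.isRoot_of_mem_roots hr
      rw [Polynomial.IsRoot, Polynomial.IsPickPair.eval_hbPoly] at h2
      refine h0.aeval_ne_zero (z := r) (by simpa using hre.le) ?_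
      simpa using h2
  · rw [aeval_lineSlice, aeval_lineSlice]
    have h1 := hne y u hy hu z hz
    rw [aeval_lineSlice] at h1
    set W : Fin n → ℂ := fun k => (y k : ℂ) + z * u k with hW
    have h2 : (lineSlice p W (Pi.single j 1)).eval 0 ≠ 0 := by
      rw [eval_lineSlice]
      simpa using h1
    have h3 := Polynomial.im_logDeriv_nonpos _ 0 h2 (fun r hr => ?_)
    · rw [derivative_lineSlice, eval_lineSlice, eval_lineSlice] at h3
      simpa using h3
    · by_contra! hc
      have h4 := Polynomial.isRoot_of_mem_roots hr
      rw [Polynomial.IsRoot, eval_lineSlice] at h4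
      refine hp.aeval_add_ne_zero (w := W) (fun k => ?_) h1 hsingle (s := r)
        (by simpa using hc) ?_
      · simpa [hW] using mul_nonneg hz.le (hu k)
      · rw [← h4]
        congr 2
        ext k
        by_cases h : k = j
        · subst h; simp
        · simp [Pi.single_eq_of_ne h]

end Stability

section Barrier

variable {n : ℕ}

lemma pderiv_pderiv_comm (i j : Fin n) (p : MvPolynomial (Fin n) ℝ) :
    pderiv i (pderiv j p) = pderiv j (pderiv i p) := by
  have h : ⁅pderiv (R := ℝ) i, pderiv (R := ℝ) j⁆ = 0 := by
    refine MvPolynomial.derivation_ext fun k => ?_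
    rw [Derivation.commutator_apply]
    simp [pderiv_X, Pi.single_apply, apply_ite (pderiv i), apply_ite (pderiv j)]
  have h1 := DFunLike.congr_fun h p
  rwa [Derivation.commutator_apply, Derivation.zero_apply, sub_eq_zero] at h1

/-- `p` is real stable, `y` is above all roots of `p`, and every logarithmic derivative of `p` is
at most `B` on the nonnegative orthant based at `y`. -/
structure BarrierAt (p : MvPolynomial (Fin n) ℝ) (y : Fin n → ℝ) (B : ℝ) : Prop where
  stable : RealStable p
  above : AboveRoots p y
  pderiv_le : ∀ t : Fin n → ℝ, (∀ i, 0 ≤ t i) → ∀ j,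
    eval (y + t) (pderiv j p) ≤ B * eval (y + t) p

/-- The scalar inequality behind the barrier shift: `f`, `q` stand for a polynomial and one of its
partial derivatives at a shifted point, primes for derivatives in the direction of the shift. -/
lemma barrier_scalar {f f' f'' q q' q'' B δ F₀ : ℝ} (hf : 0 < f) (hB : 0 < B) (hδ : 0 < δ)
    (hBδ : 2 * B / δ + B ^ 2 ≤ 2) (hf'₀ : 0 ≤ f') (hf' : f' ≤ B * f)
    (hlog : f'' * f - f' * f' ≤ 0) (hw : q' * f - q * f' ≤ 0)
    (hconv : 0 ≤ q'' * f ^ 2 - q * f * f'' - 2 * f * f' * q' + 2 * q * f' ^ 2)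
    (htan : q / f - δ * ((q' * f - q * f') / f ^ 2) ≤ F₀) (hF : F₀ ≤ B) :
    0 < f - 1 / 2 * f'' ∧ q - 1 / 2 * q'' ≤ B * (f - 1 / 2 * f'') := by
  obtain ⟨F, rfl⟩ : ∃ F, q = F * f := ⟨q / f, by field_simp⟩
  obtain ⟨W, rfl⟩ : ∃ W, q' = W * f + F * f' := ⟨(q' - F * f') / f, by field_simp; ring⟩
  have hW : W ≤ 0 := by
    have : W * (f * f) ≤ 0 := by linarith
    exact nonpos_of_mul_nonpos_left this (by positivity)
  have h2 : B ^ 2 < 2 := by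
    have : 0 < 2 * B / δ := by positivity
    linarith
  have hδ2 : B ≤ δ * (1 - 1 / 2 * B ^ 2) := by
    have h3 : 2 * B / δ ≤ 2 - B ^ 2 := by linarith
    rw [div_le_iff₀ hδ] at h3
    linarith
  have hf'' : f'' ≤ B ^ 2 * f := by
    have h4 : f' * f' ≤ (B * f) * (B * f) := mul_le_mul hf' hf' hf'₀ (by positivity)
    have h5 : f'' * f ≤ (B ^ 2 * f) * f := by linarith
    exact le_of_mul_le_mul_right h5 hf
  have hg : f * (1 - 1 / 2 * B ^ 2) ≤ f - 1 / 2 * f'' := by linarith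
  have hg0 : 0 < f - 1 / 2 * f'' :=
    lt_of_lt_of_le (mul_pos hf (by linarith)) hg
  refine ⟨hg0, ?_⟩
  have htan' : F - δ * W ≤ B := by
    have h6 : F * f / f - δ * (((W * f + F * f') * f - F * f * f') / f ^ 2) = F - δ * W := by
      field_simp
      ring
    linarith
  have hconv' : F * f'' + 2 * f' * W ≤ q'' := by
    have h7 : 0 ≤ (q'' - F * f'' - 2 * f' * W) * f ^ 2 := by linarith
    have := nonneg_of_mul_nonneg_left h7 (by positivity)
    linarith
  have h8 : f' ≤ δ * (f - 1 / 2 * f'') := by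
    have h9 := mul_le_mul_of_nonneg_right hδ2 hf.le
    have h10 := mul_le_mul_of_nonneg_left hg hδ.le
    linarith
  have h11 := mul_le_mul_of_nonneg_right htan' hg0.le
  have h12 := mul_le_mul_of_nonpos_right h8 hW
  linarith

lemma BarrierAt.halfOp {p : MvPolynomial (Fin n) ℝ} {y : Fin n → ℝ} {B δ : ℝ}
    (h : BarrierAt p y B) (hB : 0 < B) (hδ : 0 < δ) (hBδ : 2 * B / δ + B ^ 2 ≤ 2) (i : Fin n) :
    BarrierAt (halfOp i p) (y + δ • Pi.single i 1) B := by
  have hsingle : ∀ k, 0 ≤ (Pi.single i 1 : Fin n → ℝ) k := by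
    intro k
    by_cases h : k = i
    · subst h; simp
    · simp [Pi.single_eq_of_ne h]
  have key : ∀ t : Fin n → ℝ, (∀ k, 0 ≤ t k) → ∀ j,
      0 < eval (y + δ • Pi.single i 1 + t) (_root_.halfOp i p) ∧
      eval (y + δ • Pi.single i 1 + t) (pderiv j (_root_.halfOp i p)) ≤
        B * eval (y + δ • Pi.single i 1 + t) (_root_.halfOp i p) := by
    intro t ht j
    rw [add_right_comm]
    have hyt : AboveRoots p (y + t) := by
      intro s hs
      rw [add_assoc]
      exact h.above _ fun k => add_nonneg (ht k) (hs k)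
    have hi := h.stable.isPickPair hyt hsingle i
    have hj := h.stable.isPickPair hyt hsingle j
    have hB0 := h.pderiv_le t ht j
    have hBi := h.pderiv_le (t + δ • Pi.single i 1)
      (fun k => add_nonneg (ht k) (mul_nonneg hδ.le (hsingle k))) i
    rw [← add_assoc] at hBi
    have e1 := hi.pos δ hδ.le
    have e2 := hi.nonneg δ hδ.le
    have e3 := hi.wronskian_nonpos hδ.le
    have e4 := hj.wronskian_nonpos hδ.le
    have e5 := hj.second_deriv_nonneg hδ.le
    have e6 := hj.tangent_le hδ
    have e0 := hj.pos 0 le_rfl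
    simp only [derivative_lineSlice, eval_lineSlice_real, zero_smul, add_zero] at *
    have e7 := barrier_scalar e1 hB hδ hBδ e2 hBi e3 e4 e5 e6 ((div_le_iff₀ e0).2 hB0)
    have e8 : pderiv j (pderiv i (pderiv i p)) = pderiv i (pderiv i (pderiv j p)) := by
      rw [pderiv_pderiv_comm j i, pderiv_pderiv_comm j i]
    simpa [_root_.halfOp, e8] using e7
  refine ⟨h.stable.halfOp i, fun t ht => (key t ht i).1, fun t ht j => (key t ht j).2⟩

lemma BarrierAt.foldl_halfOp {B δ : ℝ} (hB : 0 < B) (hδ : 0 < δ)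
    (hBδ : 2 * B / δ + B ^ 2 ≤ 2) (l : List (Fin n)) :
    ∀ {p : MvPolynomial (Fin n) ℝ} {y : Fin n → ℝ}, BarrierAt p y B →
    BarrierAt (l.foldl (fun q i => _root_.halfOp i q) p)
      (y + δ • fun k => (l.count k : ℝ)) B := by
  induction l with
  | nil =>
    intro p y h
    simpa [← Pi.zero_def] using h
  | cons i l ih =>
    intro p y h
    have h1 := ih (h.halfOp hB hδ hBδ i)
    convert! h1 using 1
    rw [add_assoc, ← smul_add]
    congr 2
    ext k
    by_cases hk : k = i
    · subst hk; simp [add_comm]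
    · simp [hk, Ne.symm hk]

/-- The substitution `zᵢ ↦ x + zᵢ`. -/
def shift (p : MvPolynomial (Fin n) ℝ) : MvPolynomial (Fin (n + 1)) ℝ :=
  aeval (fun i : Fin n => X (0 : Fin (n + 1)) + X i.succ) p

lemma pderiv_succ_shift (i : Fin n) (p : MvPolynomial (Fin n) ℝ) :
    pderiv i.succ (shift p) = shift (pderiv i p) := by
  induction p using MvPolynomial.induction_on with
  | C a => simp [shift, algebraMap_eq]
  | add p q hp hq =>
    simp only [shift, map_add] at *
    rw [hp, hq]
  | mul_X p k hp =>
    simp only [shift, map_mul, aeval_X, Derivation.leibniz, map_add, smul_eq_mul] at *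
    rw [hp, pderiv_X_of_ne (Fin.succ_ne_zero i).symm]
    rcases eq_or_ne k i with rfl | hk
    · simp
    · simp [pderiv_X_of_ne hk, pderiv_X_of_ne (Fin.succ_injective n |>.ne hk)]

lemma eval_shift (y : Fin (n + 1) → ℝ) (p : MvPolynomial (Fin n) ℝ) :
    eval y (shift p) = eval (fun i => y 0 + y i.succ) p := by
  induction p using MvPolynomial.induction_on with
  | C a => simp [shift, algebraMap_eq]
  | add p q hp hq =>
    simp only [shift, map_add] at *
    rw [hp, hq]
  | mul_X p k hp =>
    simp only [shift, map_mul, aeval_X] at *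
    rw [hp]
    simp

lemma opAll_shift (p : MvPolynomial (Fin n) ℝ) :
    opAll (shift p) = shift ((List.finRange n).foldl (fun q i => halfOp i q) p) := by
  rw [opAll]
  generalize List.finRange n = l
  induction l generalizing p with
  | nil => rfl
  | cons i l ih =>
    rw [List.foldl_cons, List.foldl_cons, ← ih]
    congr 1
    rw [halfOp, pderiv_succ_shift, pderiv_succ_shift]
    simp [shift, algebraMap_eq]

/-- If the barrier condition holds at a constant point, the diagonal shift of the polynomial
is above all roots after applying all the operators. -/
lemma BarrierAt.aboveRoots_opAll {p : MvPolynomial (Fin n) ℝ} {B δ : ℝ}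
    (h : BarrierAt p (fun _ => δ) B) (hB : 0 < B) (hδ : 0 < δ) (hBδ : 2 * B / δ + B ^ 2 ≤ 2) :
    AboveRoots (opAll (shift p)) (Fin.cons (2 * δ) fun _ => (0 : ℝ)) := by
  intro t ht
  rw [opAll_shift, eval_shift]
  have h1 := (h.foldl_halfOp hB hδ hBδ (List.finRange n)).above
    (fun i => t 0 + t i.succ) (fun i => add_nonneg (ht _) (ht _))
  convert! h1 using 3
  ext i
  simp
  ring

end Barrier

section Hyperbolic

lemma MvPolynomial.IsHomogeneous.aeval_smul_point {k d : ℕ} {K : Type*} [CommRing K] [Algebra ℝ K]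
    {h : MvPolynomial (Fin k) ℝ} (hh : h.IsHomogeneous d) (c : K) (z : Fin k → K) :
    MvPolynomial.aeval (c • z) h = c ^ d * MvPolynomial.aeval z h := by
  rw [aeval_def, aeval_def, eval₂_eq', eval₂_eq', Finset.mul_sum]
  refine Finset.sum_congr rfl fun a ha => ?_
  have h1 : ∑ i, a i = d := by
    rw [← Finsupp.degree_eq_sum]
    by_contra hc
    exact (mem_support_iff.1 ha) (hh.coeff_eq_zero hc)
  simp only [Pi.smul_apply, smul_eq_mul, mul_pow, Finset.prod_mul_distrib,
    Finset.prod_pow_eq_pow_sum, h1]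
  ring

variable {m d : ℕ} {h : MvPolynomial (Fin m) ℝ} {e : Fin m → ℝ} {lam : (Fin m → ℝ) → Fin d → ℝ}

/-- The factorization of `h` on the line through `-x` in direction `e`, at complex parameters. -/
lemma IsHyperbolic.aeval_complex (hh : IsHyperbolic h e lam) (x : Fin m → ℝ) (t : ℂ) :
    aeval (fun k => t * e k - x k) h = (eval e h : ℂ) * ∏ i, (t - lam x i) := by
  have h1 : lineSlice h (-x) e =
      Polynomial.C (eval e h) * ∏ i, (Polynomial.X - Polynomial.C (lam x i)) := by
    refine Polynomial.funext fun s => ?_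
    rw [eval_lineSlice_real, neg_add_eq_sub, hh.2.2.2 x s]
    simp [Polynomial.eval_prod]
  have h2 := aeval_lineSlice h (-x) e t
  rw [h1] at h2
  simp only [map_mul, map_prod, map_sub, Polynomial.aeval_X, Polynomial.aeval_C] at h2
  rw [show (fun k => t * (e k : ℂ) - x k) = fun k => (((-x) k : ℝ) : ℂ) + t * e k by
    ext k; simp; ring, ← h2]
  rfl

/-- `h` does not vanish at `i a e + b u` for `u` in the open cone, `a ≥ 0` and `Im b ≥ 0`. -/
lemma IsHyperbolic.aeval_ne_zero_of_openCone (hh : IsHyperbolic h e lam) {u : Fin m → ℝ}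
    (hu : InOpenCone lam u) {a : ℝ} {b : ℂ} (ha : 0 ≤ a) (hb : 0 ≤ b.im) (hab : a ≠ 0 ∨ b ≠ 0) :
    aeval (fun k => (a : ℂ) * Complex.I * e k + b * u k) h ≠ 0 := by
  have he : (eval e h : ℂ) ≠ 0 := by exact_mod_cast hh.2.1.ne'
  rcases eq_or_ne b 0 with rfl | hb0
  · have ha0 : a ≠ 0 := by simpa using hab
    have h1 : (fun k => (a : ℂ) * Complex.I * e k + 0 * u k) =
        ((a : ℂ) * Complex.I) • fun k => (e k : ℂ) := by
      ext k; simp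
    rw [h1, hh.1.aeval_smul_point, aeval_ofReal_eq]
    exact mul_ne_zero (pow_ne_zero _ (by simp [ha0])) he
  · have h1 : (fun k => (a : ℂ) * Complex.I * e k + b * u k) =
        (-b) • fun k => (-(a * Complex.I) / b) * e k - u k := by
      ext k
      simp only [Pi.smul_apply, smul_eq_mul]
      field_simp
      ring
    rw [h1, hh.1.aeval_smul_point, hh.aeval_complex]
    refine mul_ne_zero (pow_ne_zero _ (neg_ne_zero.2 hb0)) (mul_ne_zero he ?_)
    rw [Finset.prod_ne_zero_iff]
    intro i _ h0
    have h2 : (lam u i : ℂ) * b = -(a * Complex.I) := by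
      field_simp at h0
      linear_combination -h0
    have h3 := congrArg Complex.im h2
    have h4 := congrArg Complex.re h2
    simp at h3 h4
    have h5 := hu i
    have h6 := mul_nonneg h5.le hb
    have h7 : b.im = 0 := by
      have : lam u i * b.im = 0 := by linarith
      exact (mul_eq_zero.1 this).resolve_left h5.ne'
    exact hb0 (Complex.ext (h4.resolve_left h5.ne') h7)

lemma IsHyperbolic.inOpenCone_add_smul (hh : IsHyperbolic h e lam) {v : Fin m → ℝ}
    (hv : InCone lam v) {η : ℝ} (hη : 0 < η) : InOpenCone lam (v + η • e) := by
  intro i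
  have h1 := hh.2.2.2 (v + η • e) (lam (v + η • e) i)
  have h2 := hh.2.2.2 v (lam (v + η • e) i - η)
  rw [show (lam (v + η • e) i - η) • e - v = lam (v + η • e) i • e - (v + η • e) by
    rw [sub_smul]; abel, h1, Finset.prod_eq_zero (Finset.mem_univ i) (sub_self _), mul_zero] at h2
  obtain ⟨j, -, hj⟩ := Finset.prod_eq_zero_iff.1 ((mul_eq_zero.1 h2.symm).resolve_left hh.2.1.ne')
  linarith [hv j]

/-- Adding a direction of the open hyperbolicity cone with coefficient in the closed upper half
plane preserves nonvanishing. -/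
lemma IsHyperbolic.ne_zero_add_openCone (hh : IsHyperbolic h e lam) {u : Fin m → ℝ}
    (hu : InOpenCone lam u) {W : Fin m → ℂ}
    (hW : ∀ α : ℝ, 0 < α → ∀ r : ℝ, 0 ≤ r → ∀ x : Fin m → ℝ,
      aeval (fun k => (α : ℂ) * Complex.I * e k + x k + r * W k) h ≠ 0)
    {α : ℝ} (hα : 0 < α) {σ : ℂ} (hσ : 0 ≤ σ.im) :
    aeval (fun k => (α : ℂ) * Complex.I * e k + W k + σ * u k) h ≠ 0 := by
  set H : ℝ → ℂ → ℂ := fun γ σ =>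
    aeval (fun k => (α : ℂ) * Complex.I * e k + (γ ^ 2 : ℝ) * W k + σ * u k) h with hH
  have hHc : Continuous fun p : ℝ × ℂ => H p.1 p.2 :=
    (continuous_aeval_complex h).comp (by fun_prop)
  have hreal : ∀ (γ : ℝ) (σ : ℂ), σ.im = 0 → H γ σ ≠ 0 := by
    intro γ σ h0
    have h1 := hW α hα (γ ^ 2) (sq_nonneg γ) (σ.re • u)
    have h2 : (σ.re : ℂ) = σ := Complex.ext (by simp) (by simp [h0])
    convert! h1 using 3
    ext k
    simp [h2]
    ring
  set A : Set ℝ := {γ | ∀ σ : ℂ, 0 < σ.im → H γ σ ≠ 0} with hA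
  have hclosed : IsClosed A := by
    have h1 : A = {γ | ∀ σ : ℂ, 0 < σ.im →
        (σ.im / (‖σ‖ + σ.im)) ^ h.totalDegree * ‖H γ 0‖ ≤ ‖H γ σ‖} := by
      ext γ
      refine ⟨fun hγ σ hσ => ?_, fun hγ σ hσ h0 => ?_⟩
      · have h2 := Polynomial.norm_eval_ge
          (lineSlice h (fun k => (α : ℂ) * Complex.I * e k + (γ ^ 2 : ℝ) * W k) fun k => (u k : ℂ))
          (natDegree_lineSlice_le _ _ _) (fun r hr => ?_) hσ
        · simpa only [eval_lineSlice] using h2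
        · by_contra! hc
          have h2 := Polynomial.isRoot_of_mem_roots hr
          rw [Polynomial.IsRoot, eval_lineSlice] at h2
          exact hγ r hc h2
      · have h2 := hγ σ hσ
        rw [h0, norm_zero] at h2
        have h3 := norm_pos_iff.2 (hreal γ 0 rfl)
        have : 0 < (σ.im / (‖σ‖ + σ.im)) ^ h.totalDegree * ‖H γ 0‖ := by positivity
        linarith
    rw [h1]
    simp only [Set.ofPred_forall]
    refine isClosed_iInter fun σ => isClosed_iInter fun _ => isClosed_le ?_ ?_
    · exact continuous_const.mul (hHc.comp (by fun_prop : Continuous fun γ : ℝ => (γ, (0 : ℂ)))).norm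
    · exact (hHc.comp (by fun_prop : Continuous fun γ : ℝ => (γ, σ))).norm
  have hopen : IsOpen A := by
    let K : Set (ℝ × ℂ) := {q | 0 ≤ q.1 ∧ 0 ≤ q.2.im ∧ q.1 + ‖q.2‖ = 1}
    have hK : IsCompact K := by
      refine Metric.isCompact_of_isClosed_isBounded ?_ ?_
      · exact (isClosed_le continuous_const continuous_fst).inter
          ((isClosed_le continuous_const (Complex.continuous_im.comp continuous_snd)).inter
            (isClosed_eq (by fun_prop) continuous_const))
      · refine (Metric.isBounded_closedBall (x := (0 : ℝ × ℂ)) (r := 1)).subset ?_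
        rintro ⟨a, b⟩ ⟨h1, -, h2⟩
        simp only at h1 h2
        rw [mem_closedBall_zero_iff, Prod.norm_def, max_le_iff]
        simp only [Real.norm_of_nonneg h1]
        constructor <;> linarith [norm_nonneg b]
    have : CompactSpace K := isCompact_iff_compactSpace.1 hK
    let Z : Set (K × ℝ) := {q | aeval (fun k => ((α * (q.1 : ℝ × ℂ).1 : ℝ) : ℂ) * Complex.I * e k +
      (q.1 : ℝ × ℂ).2 * u k + (q.1 : ℝ × ℂ).1 * ((q.2 ^ 2 : ℝ) * W k)) h = 0}
    have hZ : IsClosed Z :=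
      isClosed_eq ((continuous_aeval_complex h).comp (by fun_prop)) continuous_const
    have hproj := isClosedMap_snd_of_compactSpace Z hZ
    convert! hproj.isOpen_compl using 1
    ext γ
    simp only [Set.mem_compl_iff, Set.mem_image, not_exists, not_and]
    refine ⟨?_, ?_⟩
    · rintro hγ ⟨⟨⟨a, b⟩, h1, h2, h3⟩, γ'⟩ h4 rfl
      simp only at h1 h2 h3
      change aeval (fun k => ((α * a : ℝ) : ℂ) * Complex.I * e k +
        b * u k + a * ((γ' ^ 2 : ℝ) * W k)) h = 0 at h4
      rcases eq_or_ne a 0 with rfl | ha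
      · refine hh.aeval_ne_zero_of_openCone hu le_rfl h2 (Or.inr ?_) (by simpa using h4)
        rintro rfl
        simp at h3
      · have ha' : (a : ℂ) ≠ 0 := by exact_mod_cast ha
        have h5 : H γ' (b / a) = 0 := by
          have h6 : (fun k => ((α * a : ℝ) : ℂ) * Complex.I * e k +
              b * u k + a * ((γ' ^ 2 : ℝ) * W k)) = (a : ℂ) • fun k =>
              (α : ℂ) * Complex.I * e k + (γ' ^ 2 : ℝ) * W k + b / a * u k := by
            ext k
            simp only [Pi.smul_apply, smul_eq_mul]
            push_cast
            field_simp
            ring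
          rw [h6, hh.1.aeval_smul_point] at h4
          exact (mul_eq_zero.1 h4).resolve_left (pow_ne_zero _ ha')
        have h7 : 0 ≤ (b / (a : ℂ)).im := by
          rw [Complex.div_ofReal_im]
          positivity
        rcases h7.eq_or_lt with h7 | h7
        · exact hreal _ _ h7.symm h5
        · exact hγ _ h7 h5
    · intro hγ σ hσ h0
      have hp : 0 < 1 + ‖σ‖ := by positivity
      refine hγ (⟨((1 + ‖σ‖)⁻¹, ((1 + ‖σ‖)⁻¹ : ℝ) • σ), ?_, ?_, ?_⟩, γ) ?_ rfl
      · simp only; positivity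
      · simp only [Complex.smul_im, smul_eq_mul]; positivity
      · simp only [norm_smul, Real.norm_of_nonneg (inv_nonneg.2 hp.le)]
        field_simp
      · change aeval (fun k => ((α * (1 + ‖σ‖)⁻¹ : ℝ) : ℂ) * Complex.I * e k +
          ((1 + ‖σ‖)⁻¹ : ℝ) • σ * u k + ((1 + ‖σ‖)⁻¹ : ℝ) * ((γ ^ 2 : ℝ) * W k)) h = 0
        have h6 : (fun k => ((α * (1 + ‖σ‖)⁻¹ : ℝ) : ℂ) * Complex.I * e k +
            ((1 + ‖σ‖)⁻¹ : ℝ) • σ * u k + ((1 + ‖σ‖)⁻¹ : ℝ) * ((γ ^ 2 : ℝ) * W k)) =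
            (((1 + ‖σ‖)⁻¹ : ℝ) : ℂ) • fun k =>
              (α : ℂ) * Complex.I * e k + (γ ^ 2 : ℝ) * W k + σ * u k := by
          ext k
          simp only [Pi.smul_apply, smul_eq_mul, Complex.real_smul, Complex.ofReal_mul]
          ring
        rw [h6, hh.1.aeval_smul_point]
        exact mul_eq_zero_of_right _ h0
  have h0 : (0 : ℝ) ∈ A := by
    intro σ hσ
    have := hh.aeval_ne_zero_of_openCone hu hα.le hσ.le (Or.inl hα.ne')
    simpa [hH] using this
  have huniv : A = Set.univ := (IsClopen.eq_univ ⟨hclosed, hopen⟩ ⟨0, h0⟩)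
  have h1 : H 1 σ ≠ 0 := by
    rcases hσ.eq_or_lt with h2 | h2
    · exact hreal 1 σ h2.symm
    · exact (huniv ▸ Set.mem_univ (1 : ℝ) : (1 : ℝ) ∈ A) σ h2
  simpa [hH] using h1

lemma IsHyperbolic.ne_zero_add_cone (hh : IsHyperbolic h e lam) {v : Fin m → ℝ}
    (hv : InCone lam v) {W : Fin m → ℂ}
    (hW : ∀ α : ℝ, 0 < α → ∀ r : ℝ, 0 ≤ r → ∀ x : Fin m → ℝ,
      aeval (fun k => (α : ℂ) * Complex.I * e k + x k + r * W k) h ≠ 0)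
    {α : ℝ} (hα : 0 < α) {σ : ℂ} (hσ : 0 ≤ σ.im) :
    aeval (fun k => (α : ℂ) * Complex.I * e k + W k + σ * v k) h ≠ 0 := by
  have hp : 0 < 1 + σ.im := by positivity
  set η : ℝ := α / (1 + σ.im) with hη
  have hη0 : 0 < η := by positivity
  have hα' : 0 < α - η * σ.im := by
    have : α - η * σ.im = η := by rw [hη]; field_simp; ring
    rwa [this]
  have h1 := hh.ne_zero_add_openCone (hh.inOpenCone_add_smul hv hη0)
    (W := fun k => W k - (η * σ.re : ℝ) * e k) (fun α' hα' r hr x => ?_) hα' hσ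
  · convert! h1 using 3
    ext k
    simp only [Pi.add_apply, Pi.smul_apply, smul_eq_mul]
    push_cast
    linear_combination ((η : ℂ) * e k) * Complex.re_add_im σ
  · have h2 := hW α' hα' r hr (x - (r * (η * σ.re)) • e)
    convert! h2 using 3
    ext k
    simp
    ring

lemma IsHyperbolic.ne_zero_add_sum (hh : IsHyperbolic h e lam) {n : ℕ} {v : Fin n → Fin m → ℝ}
    (hv : ∀ i, InCone lam (v i)) (s : Finset (Fin n)) :
    ∀ (α : ℝ), 0 < α → ∀ (x : Fin m → ℝ) (ζ : Fin n → ℂ), (∀ i, 0 ≤ (ζ i).im) →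
      aeval (fun k => (α : ℂ) * Complex.I * e k + x k + ∑ i ∈ s, ζ i * v i k) h ≠ 0 := by
  induction s using Finset.induction_on with
  | empty =>
    intro α hα x ζ _
    have h1 := hh.aeval_complex (-x) (α * Complex.I)
    simp only [Finset.sum_empty, add_zero]
    have h2 : (fun k => (α : ℂ) * Complex.I * e k + x k) =
        fun k => (α : ℂ) * Complex.I * e k - ((-x) k : ℝ) := by
      ext k; simp
    rw [h2, h1]
    refine mul_ne_zero (by exact_mod_cast hh.2.1.ne') (Finset.prod_ne_zero_iff.2 fun i _ h0 => ?_)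
    have h3 := congrArg Complex.im h0
    simp at h3
    exact hα.ne' h3
  | insert i s hi ih =>
    intro α hα x ζ hζ
    have h1 := hh.ne_zero_add_cone (hv i) (W := fun k => x k + ∑ j ∈ s, ζ j * v j k)
      (fun α' hα' r hr x' => ?_) hα (hζ i)
    · convert! h1 using 3
      ext k
      rw [Finset.sum_insert hi]
      ring
    · have h2 := ih α' hα' (x' + r • x) (fun j => r * ζ j) fun j => by
        simpa using mul_nonneg hr (hζ j)
      convert! h2 using 3
      ext k
      simp only [Pi.add_apply, Pi.smul_apply, smul_eq_mul, mul_add, Finset.mul_sum]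
      push_cast
      simp only [mul_assoc]
      ring

/-- The pencil polynomial `z ↦ h (∑ᵢ zᵢ vᵢ)`. -/
def pencil {n : ℕ} (h : MvPolynomial (Fin m) ℝ) (v : Fin n → Fin m → ℝ) :
    MvPolynomial (Fin n) ℝ :=
  aeval (fun j => ∑ i, X i * C (v i j)) h

lemma aeval_pencil {n : ℕ} {K : Type*} [CommRing K] [Algebra ℝ K]
    (h : MvPolynomial (Fin m) ℝ) (v : Fin n → Fin m → ℝ) (z : Fin n → K) :
    aeval z (pencil h v) = aeval (fun j => ∑ i, z i * algebraMap ℝ K (v i j)) h := by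
  induction h using MvPolynomial.induction_on with
  | C a => simp [pencil, algebraMap_eq]
  | add p q hp hq =>
    simp only [pencil, map_add] at *
    rw [hp, hq]
  | mul_X p k hp =>
    simp only [pencil, map_mul, aeval_X] at *
    rw [hp]
    simp

lemma IsHyperbolic.realStable_pencil (hh : IsHyperbolic h e lam) {n : ℕ} {v : Fin n → Fin m → ℝ}
    (hv : ∀ i, InCone lam (v i)) (hsum : ∑ i, v i = e) : RealStable (pencil h v) := by
  intro z hz
  obtain ⟨η, hη, hηz⟩ : ∃ η : ℝ, 0 < η ∧ ∀ i, η ≤ (z i).im := by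
    rcases isEmpty_or_nonempty (Fin n) with hn | hn
    · exact ⟨1, one_pos, fun i => isEmptyElim i⟩
    · obtain ⟨i, hi⟩ := Finite.exists_min fun i => (z i).im
      exact ⟨_, hz i, hi⟩
  have h1 := hh.ne_zero_add_sum hv Finset.univ η hη 0 (fun i => z i - η * Complex.I)
    fun i => by simpa using hηz i
  rw [aeval_pencil]
  convert! h1 using 3
  ext k
  have h2 : e k = ∑ i, v i k := by rw [← hsum, Finset.sum_apply]
  rw [h2]
  simp only [sub_mul, Finset.sum_sub_distrib, Complex.ofReal_sum, Finset.mul_sum]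
  simp

end Hyperbolic

section Diagonal

variable {n D : ℕ} {p : MvPolynomial (Fin n) ℝ}

lemma RealStable.mul {q : MvPolynomial (Fin n) ℝ} (hp : RealStable p) (hq : RealStable q) :
    RealStable (p * q) := by
  intro z hz
  rw [map_mul]
  exact mul_ne_zero (hp z hz) (hq z hz)

lemma eq_C_of_isHomogeneous_zero (hh : p.IsHomogeneous 0) : p = C (coeff 0 p) :=
  totalDegree_eq_zero_iff_eq_C.1 ((totalDegree_zero_iff_isHomogeneous _).2 hh)

lemma RealStable.eval_pos (hp : RealStable p) (hh : p.IsHomogeneous D) (h1 : 0 < eval 1 p)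
    {y : Fin n → ℝ} (hy : ∀ i, 0 < y i) : 0 < eval y p := by
  have hne : ∀ y : Fin n → ℝ, (∀ i, 0 < y i) → eval y p ≠ 0 := by
    intro y hy h0
    refine hp (Complex.I • fun i => (y i : ℂ)) (fun i => by simpa using hy i) ?_
    rw [hh.aeval_smul_point, aeval_ofReal_eq, h0]
    simp
  by_contra! hneg
  let s : Set (Fin n → ℝ) := Set.univ.pi fun _ => Set.Ioi 0
  have hs : IsPreconnected s := (convex_pi fun _ _ => convex_Ioi 0).isPreconnected
  obtain ⟨w, hw, hw0⟩ := hs.intermediate_value (a := y) (b := 1) (fun i _ => hy i)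
    (fun i _ => Set.mem_Ioi.2 one_pos) (MvPolynomial.continuous_eval p).continuousOn ⟨hneg, h1.le⟩
  exact hne w (fun i => hw i trivial) hw0

lemma eval_const_pderiv (hh : p.IsHomogeneous D) (δ : ℝ) (j : Fin n) :
    δ * eval (fun _ => δ) (pderiv j p) = δ ^ D * eval 1 (pderiv j p) := by
  have h1 : (fun _ => δ : Fin n → ℝ) = δ • 1 := by ext; simp
  rcases D with _ | D
  · rw [eq_C_of_isHomogeneous_zero hh]
    simp
  · have h2 := (hh.pderiv (i := j)).aeval_smul_point δ (1 : Fin n → ℝ)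
    rw [MvPolynomial.aeval_eq_eval] at h2
    rw [h1]
    change δ * eval (δ • 1) (pderiv j p) = _
    have h3 : eval (δ • 1) (pderiv j p) = δ ^ (D + 1 - 1) * eval 1 (pderiv j p) := h2
    rw [h3, Nat.add_sub_cancel, pow_succ]
    ring

/-- A homogeneous real stable polynomial with logarithmic derivatives at most `ε` at the all-ones
point satisfies the barrier condition `ε / δ` at the constant point `δ`. -/
lemma RealStable.barrierAt_const (hp : RealStable p) (hh : p.IsHomogeneous D)
    (h1 : 0 < eval 1 p) {ε δ : ℝ} (hδ : 0 < δ)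
    (hε : ∀ j, eval 1 (pderiv j p) ≤ ε * eval 1 p) : BarrierAt p (fun _ => δ) (ε / δ) := by
  have habove : AboveRoots p fun _ => δ :=
    fun t ht => hp.eval_pos hh h1 fun i => add_pos_of_pos_of_nonneg hδ (ht i)
  refine ⟨hp, habove, fun t ht j => ?_⟩
  have h2 := hp.isPickPair habove ht j
  have h3 := h2.antitoneOn_div (Set.mem_Ici.2 le_rfl) (Set.mem_Ici.2 zero_le_one) zero_le_one
  simp only [eval_lineSlice_real, zero_smul, add_zero, one_smul] at h3
  rw [← div_le_iff₀ (habove t ht)]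
  refine h3.trans ?_
  have h4 : 0 < eval (fun _ => δ) p := hp.eval_pos hh h1 fun _ => hδ
  have h5 : eval (fun _ => δ) p = δ ^ D * eval 1 p := by
    have h6 := hh.aeval_smul_point δ (1 : Fin n → ℝ)
    rw [MvPolynomial.aeval_eq_eval] at h6
    rw [show (fun _ => δ : Fin n → ℝ) = δ • 1 by ext; simp]
    exact h6
  rw [div_le_div_iff₀ h4 hδ, mul_comm, eval_const_pderiv hh, h5]
  calc δ ^ D * eval 1 (pderiv j p) ≤ δ ^ D * (ε * eval 1 p) := by gcongr; exact hε j
    _ = ε * (δ ^ D * eval 1 p) := by ring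

/-- If all logarithmic derivatives of a homogeneous polynomial at the all-ones point are
nonpositive, then the polynomial is constant. -/
lemma degree_eq_zero_of_pderiv_nonpos (hh : p.IsHomogeneous D) (h1 : 0 < eval 1 p)
    (hle : ∀ j, eval 1 (pderiv j p) ≤ 0) : D = 0 := by
  have h2 := congrArg (eval 1) hh.sum_X_mul_pderiv
  simp only [map_sum, map_mul, eval_X, Pi.one_apply, one_mul, nsmul_eq_mul, map_natCast] at h2
  have h3 : (D : ℝ) * eval 1 p ≤ 0 := h2 ▸ Finset.sum_nonpos fun j _ => hle j
  have h4 := nonpos_of_mul_nonpos_left h3 h1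
  exact_mod_cast le_antisymm h4 (Nat.cast_nonneg D)

lemma opAll_C (c : ℝ) : opAll (C c : MvPolynomial (Fin (n + 1)) ℝ) = C c := by
  rw [opAll]
  induction List.finRange n with
  | nil => rfl
  | cons i l ih => simpa using ih

/-- The barrier bound for a homogeneous real stable polynomial. -/
lemma RealStable.aboveRoots_opAll (hp : RealStable p) (hh : p.IsHomogeneous D)
    (h1 : 0 < eval 1 p) {ε : ℝ} (hε : ∀ j, eval 1 (pderiv j p) ≤ ε * eval 1 p) :
    AboveRoots (opAll (shift p)) (Fin.cons (√(4 * ε + 2 * ε ^ 2)) fun _ => (0 : ℝ)) := by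
  rcases le_or_gt ε 0 with h0 | h0
  · obtain rfl := degree_eq_zero_of_pderiv_nonpos hh h1
      fun j => (hε j).trans (mul_nonpos_of_nonpos_of_nonneg h0 h1.le)
    rw [eq_C_of_isHomogeneous_zero hh] at h1 ⊢
    intro t _
    rw [shift, aeval_C, algebraMap_eq, opAll_C]
    simpa using h1
  · set α := √(4 * ε + 2 * ε ^ 2) with hα
    have hα2 : α ^ 2 = 4 * ε + 2 * ε ^ 2 := Real.sq_sqrt (by positivity)
    have hα0 : 0 < α := Real.sqrt_pos.2 (by positivity)
    have h2 := (hp.barrierAt_const hh h1 (half_pos hα0) hε).aboveRoots_opAll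
      (by positivity) (half_pos hα0) ?_
    · rwa [mul_div_cancel₀ α two_ne_zero] at h2
    · have h3 : 2 * (ε / (α / 2)) / (α / 2) + (ε / (α / 2)) ^ 2 = 2 := by
        field_simp
        linarith
      exact h3.le

end Diagonal

section Product

variable {m d n : ℕ} {h : MvPolynomial (Fin m) ℝ} {e : Fin m → ℝ}
  {lam : (Fin m → ℝ) → Fin d → ℝ} {v : Fin n → Fin m → ℝ}

lemma eval_pencil (z : Fin n → ℝ) : eval z (pencil h v) = eval (∑ i, z i • v i) h := by
  have h1 := aeval_pencil h v z
  rw [MvPolynomial.aeval_eq_eval, MvPolynomial.aeval_eq_eval] at h1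
  convert! h1 using 3
  ext j
  simp

lemma isHomogeneous_pencil (hh : h.IsHomogeneous d) : (pencil h v).IsHomogeneous d := by
  have h1 := hh.aeval (fun j => ∑ i, X i * C (v i j)) (n := 1) fun j =>
    IsHomogeneous.sum _ _ _ fun i _ => by
      simpa using (isHomogeneous_X ℝ i).mul (isHomogeneous_C (Fin n) (v i j))
  rwa [one_mul] at h1

lemma hPoly_eq_shift_pencil (hsum : ∑ i, v i = e) : hPoly h e v = shift (pencil h v) := by
  rw [hPoly, shift, aeval_pencil]
  congr 2
  ext1 j
  rw [← hsum, Finset.sum_apply, map_sum, Finset.mul_sum, ← Finset.sum_add_distrib]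
  exact Finset.sum_congr rfl fun i _ => (add_mul _ _ _).symm

/-- The factorization of `h` on the line through `e` in direction `v`. -/
lemma IsHyperbolic.lineSlice_eq (hh : IsHyperbolic h e lam) (v : Fin m → ℝ) :
    lineSlice h e v =
      Polynomial.C (eval e h) * ∏ i, (1 + Polynomial.C (lam v i) * Polynomial.X) := by
  refine Polynomial.eq_of_infinite_eval_eq _ _
    ((Set.finite_singleton (0 : ℝ)).infinite_compl.mono fun s hs => ?_)
  have hs0 : s ≠ 0 := hs
  have h1 := hh.1.aeval_smul_point (-s) ((-s)⁻¹ • e - v)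
  rw [MvPolynomial.aeval_eq_eval] at h1
  change eval (-s • ((-s)⁻¹ • e - v)) h = (-s) ^ d * eval ((-s)⁻¹ • e - v) h at h1
  rw [hh.2.2.2, show -s • ((-s)⁻¹ • e - v) = e + s • v by
    rw [smul_sub, smul_inv_smul₀ (neg_ne_zero.2 hs0), neg_smul, sub_neg_eq_add]] at h1
  rw [Set.mem_ofPred_eq, eval_lineSlice_real, h1, mul_left_comm]
  simp only [Polynomial.eval_mul, Polynomial.eval_C, Polynomial.eval_prod, Polynomial.eval_add,
    Polynomial.eval_one, Polynomial.eval_X]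
  congr 1
  rw [show (-s) ^ d = ∏ _i : Fin d, (-s) by simp, ← Finset.prod_mul_distrib]
  refine Finset.prod_congr rfl fun i _ => ?_
  field_simp
  ring

lemma IsHyperbolic.eval_pderiv_pencil (hh : IsHyperbolic h e lam) (hsum : ∑ i, v i = e)
    (j : Fin n) :
    eval 1 (pderiv j (pencil h v)) = eval e h * htrace lam (v j) := by
  have h1 : lineSlice (pencil h v) 1 (Pi.single j 1) = lineSlice h e (v j) := by
    refine Polynomial.funext fun s => ?_
    rw [eval_lineSlice_real, eval_lineSlice_real, eval_pencil]
    congr 2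
    rw [← hsum]
    simp [add_smul, Finset.sum_add_distrib, Pi.single_apply]
  have h2 := congrArg (fun q => (Polynomial.derivative q).eval 0) h1
  simp only [derivative_lineSlice, eval_lineSlice_real, zero_smul, add_zero] at h2
  rw [h2, hh.lineSlice_eq]
  rw [Polynomial.derivative_C_mul, Polynomial.derivative_prod_finset]
  simp [Polynomial.eval_finsetSum, Polynomial.eval_prod, htrace]

lemma eval_one_genPoly (μ : Finset (Fin n) → ℝ) : eval 1 (genPoly μ) = ∑ S, μ S := by
  simp [genPoly]

lemma eval_one_pderiv_genPoly (μ : Finset (Fin n) → ℝ) (j : Fin n) :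
    eval 1 (pderiv j (genPoly μ)) = ∑ T ∈ Finset.univ.filter (fun T => j ∈ T), μ T := by
  have h1 : ∀ S : Finset (Fin n), eval 1 (pderiv j (∏ i ∈ S, X i : MvPolynomial (Fin n) ℝ)) =
      if j ∈ S then 1 else 0 := by
    intro S
    induction S using Finset.induction_on with
    | empty => simp
    | insert i S hi ih =>
      rw [Finset.prod_insert hi, pderiv_mul, map_add, map_mul, map_mul, ih]
      rcases eq_or_ne i j with rfl | hij
      · simp [hi]
      · simp [pderiv_X_of_ne hij, hij.symm]
  rw [Finset.sum_filter, genPoly, map_sum, map_sum]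
  refine Finset.sum_congr rfl fun S _ => ?_
  rw [pderiv_C_mul, map_mul, eval_C, h1]
  simp

end Product

/-- Barrier bound for the strongly Rayleigh setting: `(√(4ε + 2ε²), 0, …, 0)` is above
all roots of `∏ i (1 - (1/2) ∂²_{z i}) [h(xe + ∑ z i v i) · g_μ(x𝟏 + z)]`. -/
theorem sr_barrier_bound
    {m d n : ℕ} (h : MvPolynomial (Fin m) ℝ) (e : Fin m → ℝ)
    (lam : (Fin m → ℝ) → Fin d → ℝ)
    (hhyp : IsHyperbolic h e lam) (he : InOpenCone lam e)
    (v : Fin n → Fin m → ℝ)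
    (hv : ∀ i, InCone lam (v i))
    (hsum : ∑ i, v i = e)
    (ε₁ ε₂ : ℝ)
    (htr : ∀ i, htrace lam (v i) ≤ ε₂)
    (μ : Finset (Fin n) → ℝ) (hprob : IsProbDist μ)
    (hSR : RealStable (genPoly μ))
    (dμ : ℕ) (hhom : (genPoly μ).IsHomogeneous dμ)
    (hmarg : ∀ i : Fin n, ∑ T ∈ Finset.univ.filter (fun T => i ∈ T), μ T ≤ ε₁) :
    AboveRoots
      (opAll (hPoly h e v *
        aeval (fun i : Fin n => X (0 : Fin (n + 1)) + X i.succ) (genPoly μ)))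
      (Fin.cons (Real.sqrt (4 * (ε₁ + ε₂) + 2 * (ε₁ + ε₂) ^ 2)) fun _ => (0 : ℝ)) := by
  rw [hPoly_eq_shift_pencil hsum]
  have h1 : shift (pencil h v) * aeval (fun i : Fin n => X (0 : Fin (n + 1)) + X i.succ) (genPoly μ)
      = shift (pencil h v * genPoly μ) := (map_mul _ _ _).symm
  have hh1 : eval 1 (pencil h v) = eval e h := by
    rw [eval_pencil, ← hsum]
    simp
  have hg1 : eval 1 (genPoly μ) = 1 := by rw [eval_one_genPoly, hprob.2]
  have hp1 : eval 1 (pencil h v * genPoly μ) = eval e h := by rw [map_mul, hh1, hg1, mul_one]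
  rw [h1]
  refine ((hhyp.realStable_pencil hv hsum).mul hSR).aboveRoots_opAll
    ((isHomogeneous_pencil hhyp.1).mul hhom) (hp1 ▸ hhyp.2.1) fun j => ?_
  rw [hp1, pderiv_mul, map_add, map_mul, map_mul, hhyp.eval_pderiv_pencil hsum,
    eval_one_pderiv_genPoly, hh1, hg1, mul_one, ← mul_add, mul_comm]
  exact mul_le_mul_of_nonneg_right (by linarith [htr j, hmarg j]) hhyp.2.1.le
end
end

section
/- Let h ∈ ℝ[x₁,…,x_m] be a nonzero homogeneous real stable polynomial, and let e ∈ ℝ^m have all coordinates strictly positive. Then for every x ∈ ℝ^m the univariate polynomial t ↦ h(t·e − x) has only real roots; that is, h is hyperbolic with respect to every direction e ∈ ℝ^m_{>0} (whenever h(e) > 0). -/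
open MvPolynomial Finset
open scoped Classical

noncomputable section

/-- A univariate real polynomial is real-rooted: all complex roots are real. -/
def RealRooted (q : Polynomial ℝ) : Prop :=
  ∀ z : ℂ, Polynomial.aeval z q = 0 → z.im = 0

/-- the univariate polynomial `t ↦ h (t • e + u)`. -/
def uniPoly {m : ℕ} (h : MvPolynomial (Fin m) ℝ) (e u : Fin m → ℝ) : Polynomial ℝ :=
  aeval (fun j : Fin m => Polynomial.C (e j) * Polynomial.X + Polynomial.C (u j)) h

theorem aeval_uniPoly {m : ℕ} (h : MvPolynomial (Fin m) ℝ) (e u : Fin m → ℝ) (z : ℂ) :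
    Polynomial.aeval z (uniPoly h e u) =
      aeval (fun j => (e j : ℂ) * z + (u j : ℂ)) h := by
  rw [uniPoly, MvPolynomial.comp_aeval_apply]
  congr 2
  funext j
  simp

theorem RealStable.aeval_uniPoly_ne_zero {m : ℕ} {h : MvPolynomial (Fin m) ℝ}
    (hstab : RealStable h) {e : Fin m → ℝ} (he : ∀ i, 0 < e i) (u : Fin m → ℝ) {z : ℂ}
    (hz : 0 < z.im) : Polynomial.aeval z (uniPoly h e u) ≠ 0 := by
  rw [aeval_uniPoly]
  refine hstab _ fun i => ?_
  simpa using mul_pos (he i) hz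

/-- A nonzero homogeneous real stable polynomial is hyperbolic with respect to every
direction with strictly positive coordinates. -/
theorem real_stable_implies_hyperbolic
    {m : ℕ} (h : MvPolynomial (Fin m) ℝ) (hne : h ≠ 0)
    (hhom : ∃ dd, h.IsHomogeneous dd)
    (hstab : RealStable h)
    (e : Fin m → ℝ) (he : ∀ i, 0 < e i) :
    ∀ x : Fin m → ℝ, RealRooted (uniPoly h e (-x)) := by
  intro x z hz
  rcases lt_trichotomy z.im 0 with hlt | heq | hgt
  · have hconj : 0 < (starRingEnd ℂ z).im := by simpa using hlt
    refine absurd ?_ (hstab.aeval_uniPoly_ne_zero he (-x) hconj)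
    rw [Polynomial.aeval_conj, hz, map_zero]
  · exact heq
  · exact absurd hz (hstab.aeval_uniPoly_ne_zero he (-x) hgt)
end
end
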